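/- Let (W, S) be a finite (spherical) Coxeter system and c a Coxeter element (a product of all the simple reflections, each occurring exactly once, in some order). Then the poset NC(W, c) = {u ∈ W : u ≤_T c} of non-crossing partitions, ordered by the absolute order ≤_T, is a lattice: every pair of elements of NC(W, c) has a least upper bound and a greatest lower bound within NC(W, c). -/

import Mathlib

/-- The reflection length `ℓ_T w` of `w` in a Coxeter system: the least `k` such that
`w` is a product of `k` reflections. -/
noncomputable def reflLen {B W : Type*} [Group W] {M : CoxeterMatrix B}
    (cs : CoxeterSystem M W) (w : W) : ℕ :=
  sInf {k | ∃ l : List W, l.length = k ∧ (∀ t ∈ l, cs.IsReflection t) ∧ l.prod = w}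

/-- The absolute order on `W`: `u ≤_T v` iff `ℓ_T(u) + ℓ_T(u⁻¹ v) = ℓ_T(v)`. -/
noncomputable def absLe {B W : Type*} [Group W] {M : CoxeterMatrix B}
    (cs : CoxeterSystem M W) (u v : W) : Prop :=
  reflLen cs u + reflLen cs (u⁻¹ * v) = reflLen cs v

open Module

/-- The Chebyshev-type recurrence with parameter `c` governing a rank two reflection
representation. -/
def rankTwoCoeff (c : ℝ) : ℕ → ℝ
  | 0 => 0
  | 1 => 1
  | k + 2 => 2 * c * rankTwoCoeff c (k + 1) - rankTwoCoeff c k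

theorem rankTwoCoeff_one (k : ℕ) : rankTwoCoeff 1 k = k := by
  induction k using Nat.twoStepInduction with
  | zero => simp [rankTwoCoeff]
  | one => simp [rankTwoCoeff]
  | more k h₁ h₂ => rw [rankTwoCoeff, h₁, h₂]; push_cast; ring

theorem rankTwoCoeff_cos_mul_sin (θ : ℝ) (k : ℕ) :
    rankTwoCoeff (Real.cos θ) k * Real.sin θ = Real.sin (k * θ) := by
  induction k using Nat.twoStepInduction with
  | zero => simp [rankTwoCoeff]
  | one => simp [rankTwoCoeff]
  | more k h₁ h₂ =>
    rw [rankTwoCoeff, sub_mul, h₁, mul_assoc, h₂]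
    have e₁ : ((k + 2 : ℕ) : ℝ) * θ = ((k + 1 : ℕ) : ℝ) * θ + θ := by push_cast; ring
    have e₂ : (k : ℝ) * θ = ((k + 1 : ℕ) : ℝ) * θ - θ := by push_cast; ring
    rw [e₁, e₂, Real.sin_add, Real.sin_sub]
    ring

namespace CoxeterMatrix

variable {B : Type*} (M : CoxeterMatrix B)

/-- The cosine of the angle `π / m`, with the convention that `m = 0` stands for `∞`. -/
noncomputable def angleCos (m : ℕ) : ℝ := if m = 0 then 1 else Real.cos (Real.pi / m)

/-- The linear form `x ↦ 2 b(x, αᵢ)` for the Coxeter bilinear form `b`. -/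
noncomputable def simpleForm (i : B) : (B →₀ ℝ) →ₗ[ℝ] ℝ :=
  Finsupp.linearCombination ℝ fun j ↦ -(2 * angleCos (M j i))

/-- The simple reflection in the Tits representation. -/
noncomputable def titsReflection (i : B) : Module.End ℝ (B →₀ ℝ) :=
  LinearMap.id - (M.simpleForm i).smulRight (Finsupp.single i 1)

theorem titsReflection_apply (i : B) (x : B →₀ ℝ) :
    M.titsReflection i x = x - M.simpleForm i x • Finsupp.single i 1 := rfl

theorem simpleForm_single (i j : B) :
    M.simpleForm i (Finsupp.single j 1) = -(2 * angleCos (M j i)) := by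
  simp [simpleForm]

theorem simpleForm_single_self (i : B) : M.simpleForm i (Finsupp.single i 1) = 2 := by
  simp [simpleForm_single, angleCos]

theorem titsReflection_single_self (i : B) :
    M.titsReflection i (Finsupp.single i 1) = -Finsupp.single i 1 := by
  rw [titsReflection_apply, simpleForm_single_self]; module

theorem titsReflection_single (i j : B) :
    M.titsReflection i (Finsupp.single j 1) =
      Finsupp.single j 1 + (2 * angleCos (M j i)) • Finsupp.single i 1 := by
  rw [titsReflection_apply, simpleForm_single]; module

theorem titsReflection_mul_self (i : B) : M.titsReflection i * M.titsReflection i = 1 := by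
  refine LinearMap.ext fun x ↦ ?_
  simp only [Module.End.mul_apply, Module.End.one_apply]
  rw [titsReflection_apply, titsReflection_apply, map_sub, map_smul, simpleForm_single_self]
  simp only [smul_eq_mul]
  module

theorem alternating_titsReflection_single (i j : B) (k : ℕ) :
    ((CoxeterSystem.alternatingWord i j k).map M.titsReflection).prod (Finsupp.single i 1) =
      if Even k then
        rankTwoCoeff (angleCos (M i j)) (k + 1) • Finsupp.single i 1 +
          rankTwoCoeff (angleCos (M i j)) k • Finsupp.single j 1
      else rankTwoCoeff (angleCos (M i j)) k • Finsupp.single i 1 +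
          rankTwoCoeff (angleCos (M i j)) (k + 1) • Finsupp.single j 1 := by
  induction k with
  | zero => simp [CoxeterSystem.alternatingWord, rankTwoCoeff]
  | succ k ih =>
    rw [CoxeterSystem.alternatingWord_succ', List.map_cons, List.prod_cons,
      Module.End.mul_apply, ih]
    by_cases hk : Even k
    · have hk' : ¬ Even (k + 1) := by simp [hk, Nat.even_add_one]
      rw [if_pos hk, if_pos hk, if_neg hk', map_add, map_smul, map_smul, titsReflection_single,
        titsReflection_single_self, rankTwoCoeff]
      module
    · have hk' : Even (k + 1) := by simp [hk, Nat.even_add_one]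
      rw [if_neg hk, if_neg hk, if_pos hk', map_add, map_smul, map_smul,
        titsReflection_single_self, titsReflection_single, rankTwoCoeff, M.symmetric j i]
      module

theorem prod_map_alternatingWord_two_mul {G : Type*} [Monoid G] (f : B → G) (i j : B) (m : ℕ) :
    ((CoxeterSystem.alternatingWord i j (2 * m)).map f).prod = (f i * f j) ^ m := by
  induction m with
  | zero => simp [CoxeterSystem.alternatingWord]
  | succ m ih =>
    rw [show 2 * (m + 1) = 2 * m + 1 + 1 from rfl, CoxeterSystem.alternatingWord_succ',
      CoxeterSystem.alternatingWord_succ', List.map_cons, List.map_cons, List.prod_cons,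
      List.prod_cons, ih, pow_succ']
    simp [mul_assoc]

theorem sin_pi_div_pos {m : ℕ} (hm : 2 ≤ m) : 0 < Real.sin (Real.pi / m) := by
  have : (2 : ℝ) ≤ m := by exact_mod_cast hm
  refine Real.sin_pos_of_pos_of_lt_pi (by positivity) ?_
  rw [div_lt_iff₀ (by positivity)]
  nlinarith [Real.pi_pos]

theorem two_le_of_ne {i j : B} (hij : i ≠ j) (h0 : M i j ≠ 0) : 2 ≤ M i j := by
  have := M.off_diagonal i j hij
  omega

theorem titsReflection_mul_pow_single (i j : B) (hij : i ≠ j) (h0 : M i j ≠ 0) :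
    ((M.titsReflection i * M.titsReflection j) ^ M i j) (Finsupp.single i 1) =
      Finsupp.single i 1 := by
  have h2 := M.two_le_of_ne hij h0
  have hs := sin_pi_div_pos h2
  have hm : (M i j : ℝ) ≠ 0 := by exact_mod_cast h0
  rw [← prod_map_alternatingWord_two_mul, alternating_titsReflection_single]
  have hc : angleCos (M i j) = Real.cos (Real.pi / M i j) := by simp [angleCos, h0]
  have e₁ : rankTwoCoeff (angleCos (M i j)) (2 * M i j) = 0 := by
    have := rankTwoCoeff_cos_mul_sin (Real.pi / M i j) (2 * M i j)
    rw [show ((2 * M i j : ℕ) : ℝ) * (Real.pi / M i j) = 2 * Real.pi by push_cast; field_simp,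
      Real.sin_two_pi] at this
    rw [hc]
    exact (mul_eq_zero.1 this).resolve_right hs.ne'
  have e₂ : rankTwoCoeff (angleCos (M i j)) (2 * M i j + 1) = 1 := by
    have := rankTwoCoeff_cos_mul_sin (Real.pi / M i j) (2 * M i j + 1)
    rw [show ((2 * M i j + 1 : ℕ) : ℝ) * (Real.pi / M i j) = Real.pi / M i j + 2 * Real.pi by
      push_cast; field_simp; ring, Real.sin_add_two_pi] at this
    rw [hc]
    exact mul_right_cancel₀ hs.ne' (this.trans (one_mul _).symm)
  simp [e₁, e₂]

theorem isLiftable_titsReflection : M.IsLiftable M.titsReflection := by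
  intro i j
  by_cases hij : i = j
  · subst hij
    rw [titsReflection_mul_self, one_pow]
  by_cases h0 : M i j = 0
  · rw [h0, pow_zero]
  set a := M.titsReflection i
  set b := M.titsReflection j
  have hi : ((a * b) ^ M i j) (Finsupp.single i 1) = Finsupp.single i 1 :=
    M.titsReflection_mul_pow_single i j hij h0
  have hinv : (a * b) ^ M i j * (b * a) ^ M i j = 1 := by
    have h : (a * b) * (b * a) = 1 := by
      rw [mul_assoc, ← mul_assoc b, M.titsReflection_mul_self, one_mul, M.titsReflection_mul_self]
    have h' : (b * a) * (a * b) = 1 := by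
      rw [mul_assoc, ← mul_assoc a, M.titsReflection_mul_self, one_mul, M.titsReflection_mul_self]
    have hcomm : Commute (a * b) (b * a) := by rw [Commute, SemiconjBy, h, h']
    rw [← hcomm.mul_pow, h, one_pow]
  have hj : ((a * b) ^ M i j) (Finsupp.single j 1) = Finsupp.single j 1 := by
    have h := M.titsReflection_mul_pow_single j i (Ne.symm hij) (by rwa [M.symmetric])
    rw [M.symmetric j i] at h
    conv_lhs => rw [← h]
    rw [← Module.End.mul_apply, hinv, Module.End.one_apply]
  have hfix : ∀ z : B →₀ ℝ, M.simpleForm i z = 0 → M.simpleForm j z = 0 →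
      ((a * b) ^ M i j) z = z := by
    intro z hz hz'
    have h : (a * b) z = z := by
      rw [Module.End.mul_apply, M.titsReflection_apply j, hz', zero_smul, sub_zero,
        M.titsReflection_apply, hz, zero_smul, sub_zero]
    generalize M i j = m
    induction m with
    | zero => simp
    | succ m ih => rw [pow_succ, Module.End.mul_apply, h, ih]
  have h2 := M.two_le_of_ne hij h0
  have hs := sin_pi_div_pos h2
  have hc : angleCos (M i j) = Real.cos (Real.pi / M i j) := by simp [angleCos, h0]
  set c := angleCos (M i j)
  have hc1 : 1 - c ^ 2 ≠ 0 := by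
    rw [hc, ← Real.sin_sq]; positivity
  refine LinearMap.ext fun z ↦ ?_
  set p := M.simpleForm i z
  set q := M.simpleForm j z
  set u := (p + c * q) / (2 * (1 - c ^ 2))
  set v := (q + c * p) / (2 * (1 - c ^ 2))
  have hu : p = 2 * u - 2 * c * v := by simp only [u, v]; field_simp; ring
  have hv : q = 2 * v - 2 * c * u := by simp only [u, v]; field_simp; ring
  have hji : angleCos (M j i) = c := by rw [M.symmetric j i]
  have h := hfix (z - u • Finsupp.single i 1 - v • Finsupp.single j 1)
    (by simp only [map_sub, map_smul, simpleForm_single_self, simpleForm_single, smul_eq_mul, hji]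
        change p - _ - _ = 0
        rw [hu]; ring)
    (by simp only [map_sub, map_smul, simpleForm_single_self, simpleForm_single, smul_eq_mul]
        change q - _ - _ = 0
        rw [hv]; ring)
  rw [map_sub, map_sub, map_smul, map_smul, hi, hj] at h
  simpa using h

theorem rankTwoCoeff_angleCos_nonneg {m k : ℕ} (hm : m ≠ 1) (hk : m ≠ 0 → k ≤ m) :
    0 ≤ rankTwoCoeff (angleCos m) k := by
  by_cases h0 : m = 0
  · simp [angleCos, h0, rankTwoCoeff_one]
  have hk := hk h0
  have hs := sin_pi_div_pos (m := m) (by omega)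
  have hmpos : (0 : ℝ) < m := by exact_mod_cast Nat.pos_of_ne_zero h0
  have h := rankTwoCoeff_cos_mul_sin (Real.pi / m) k
  have hnn : 0 ≤ Real.sin (k * (Real.pi / m)) := by
    refine Real.sin_nonneg_of_nonneg_of_le_pi (by positivity) ?_
    rw [← mul_div_assoc, div_le_iff₀ hmpos]
    have : (k : ℝ) ≤ m := by exact_mod_cast hk
    nlinarith [Real.pi_pos]
  rw [← h] at hnn
  rw [angleCos, if_neg h0]
  exact nonneg_of_mul_nonneg_left hnn hs

end CoxeterMatrix

namespace CoxeterSystem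

variable {B W : Type*} [Group W] {M : CoxeterMatrix B} (cs : CoxeterSystem M W)

/-- The Tits representation of a Coxeter system. -/
noncomputable def titsRep : W →* Module.End ℝ (B →₀ ℝ) :=
  cs.lift ⟨M.titsReflection, M.isLiftable_titsReflection⟩

theorem titsRep_simple (i : B) : cs.titsRep (cs.simple i) = M.titsReflection i :=
  cs.lift_apply_simple _ i

theorem titsRep_wordProd (ω : List B) :
    cs.titsRep (cs.wordProd ω) = (ω.map M.titsReflection).prod := by
  rw [wordProd, map_list_prod, List.map_map]
  congr 2
  exact funext fun i ↦ cs.titsRep_simple i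

theorem titsRep_single_nonneg (w : W) (i : B) (h : cs.length (w * cs.simple i) = cs.length w + 1) :
    0 ≤ cs.titsRep w (Finsupp.single i 1) := by
  induction hn : cs.length w using Nat.strong_induction_on generalizing w i with
  | _ n ih =>
  by_cases hw : w = 1
  · subst hw; simp
  obtain ⟨j, hj⟩ := cs.exists_rightDescent_of_ne_one hw
  rw [cs.isRightDescent_iff] at hj
  have hij : i ≠ j := by rintro rfl; omega
  let Q : ℕ → Prop := fun k ↦ ∃ v, w = v * cs.wordProd (alternatingWord i j k) ∧
    cs.length v + k = cs.length w
  have hQ1 : Q 1 := ⟨w * cs.simple j, by simp [alternatingWord], hj⟩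
  have hQle : ∀ k, Q k → k ≤ cs.length w := by rintro k ⟨v, -, hv⟩; omega
  classical
  have hmax : ∃ k, 1 ≤ k ∧ Q k ∧ ¬ Q (k + 1) := by
    by_contra! hcon
    have hall : ∀ k, 1 ≤ k → Q k := fun k hk ↦ Nat.le_induction hQ1 (fun k hk h ↦ hcon k hk h) k hk
    have := hQle _ (hall (cs.length w + 1) (by omega))
    omega
  obtain ⟨k, hk1, ⟨v, hwv, hlen⟩, hnot⟩ := hmax
  obtain ⟨k, rfl⟩ : ∃ k', k = k' + 1 := ⟨k - 1, by omega⟩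
  have hfirst : cs.length (v * cs.simple (if Even k then j else i)) = cs.length v + 1 := by
    refine (cs.length_mul_simple v _).resolve_right fun hlt ↦ ?_
    have e : w = (v * cs.simple (if Even k then j else i)) *
        cs.wordProd (alternatingWord i j k) := by
      rw [hwv, alternatingWord_succ', wordProd_cons, mul_assoc]
    have h₁ := cs.length_mul_le (v * cs.simple (if Even k then j else i))
      (cs.wordProd (alternatingWord i j k))
    have h₂ := cs.length_wordProd_le (alternatingWord i j k)
    rw [length_alternatingWord] at h₂
    rw [← e] at h₁
    omega
  have hsecond : cs.length (v * cs.simple (if Even k then i else j)) = cs.length v + 1 := by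
    refine (cs.length_mul_simple v _).resolve_right fun hlt ↦ hnot ?_
    refine ⟨v * cs.simple (if Even k then i else j), ?_, by omega⟩
    rw [alternatingWord_succ' i j (k + 1), wordProd_cons]
    by_cases hk : Even k <;> simp [hk, Nat.even_add_one, hwv, mul_assoc]
  have hvi : 0 ≤ cs.titsRep v (Finsupp.single i 1) := by
    refine ih (cs.length v) (by omega) v i ?_ rfl
    split_ifs at hfirst hsecond <;> assumption
  have hvj : 0 ≤ cs.titsRep v (Finsupp.single j 1) := by
    refine ih (cs.length v) (by omega) v j ?_ rfl
    split_ifs at hfirst hsecond <;> assumption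
  have hkM : M i j ≠ 0 → k + 1 + 1 ≤ M i j := by
    intro h0
    by_contra! hlt
    have hnr := cs.not_isReduced_alternatingWord j i (m := k + 1 + 1) (by rwa [M.symmetric])
      (by rw [M.symmetric]; omega)
    apply hnr
    rw [IsReduced, length_alternatingWord]
    have h₁ := cs.length_wordProd_le (alternatingWord j i (k + 1 + 1))
    rw [length_alternatingWord] at h₁
    have h₂ := cs.length_mul_le v (cs.wordProd (alternatingWord j i (k + 1 + 1)))
    rw [alternatingWord_succ j i, wordProd_concat, ← mul_assoc, ← hwv, h] at h₂
    rw [alternatingWord_succ j i, wordProd_concat] at h₁ ⊢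
    omega
  have hM1 := M.off_diagonal i j hij
  have hp := CoxeterMatrix.rankTwoCoeff_angleCos_nonneg hM1 (k := k + 1 + 1) hkM
  have hp' := CoxeterMatrix.rankTwoCoeff_angleCos_nonneg hM1 (k := k + 1) fun h ↦ by have := hkM h; omega
  rw [hwv, map_mul, Module.End.mul_apply, titsRep_wordProd, M.alternating_titsReflection_single]
  split_ifs <;> rw [map_add, map_smul, map_smul] <;>
    exact add_nonneg (smul_nonneg (by assumption) (by assumption))
      (smul_nonneg (by assumption) (by assumption))

theorem titsRep_single_nonpos (w : W) (i : B) (h : cs.length (w * cs.simple i) + 1 = cs.length w) :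
    cs.titsRep w (Finsupp.single i 1) ≤ 0 := by
  have := cs.titsRep_single_nonneg (w * cs.simple i) i (by simp [h])
  rw [map_mul, Module.End.mul_apply, titsRep_simple, M.titsReflection_single_self, map_neg] at this
  exact neg_nonneg.1 this

end CoxeterSystem

open scoped InnerProductSpace

/-- A realization of a Coxeter system as a reflection group in a Euclidean space: an isometric
representation together with a basis of simple roots, such that every root is positive or
negative, and every nontrivial element makes some simple root negative. -/
structure EuclideanRealization {B W : Type*} [Group W] {M : CoxeterMatrix B}
    (cs : CoxeterSystem M W) (V : Type*) [NormedAddCommGroup V] [InnerProductSpace ℝ V] where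
  ρ : W →* Module.End ℝ V
  isometry : ∀ w x y, ⟪ρ w x, ρ w y⟫_ℝ = ⟪x, y⟫_ℝ
  α : Basis B ℝ V
  simple : ∀ i x, ∃ a : ℝ, ρ (cs.simple i) x = x - a • α i
  simple_self : ∀ i, ρ (cs.simple i) (α i) = -α i
  nonneg_or_nonpos : ∀ w i, 0 ≤ α.repr (ρ w (α i)) ∨ α.repr (ρ w (α i)) ≤ 0
  exists_nonpos : ∀ w, w ≠ 1 → ∃ i, α.repr (ρ w (α i)) ≤ 0

theorem exists_euclideanRealization {B W : Type*} [Group W] [Finite W] [Finite B]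
    {M : CoxeterMatrix B} (cs : CoxeterSystem M W) :
    ∃ (_ : NormedAddCommGroup (B →₀ ℝ)) (_ : InnerProductSpace ℝ (B →₀ ℝ)),
      Nonempty (EuclideanRealization cs (B →₀ ℝ)) := by
  classical
  have : Fintype W := Fintype.ofFinite W
  have : Fintype B := Fintype.ofFinite B
  let core : InnerProductSpace.Core ℝ (B →₀ ℝ) :=
    { inner := fun x y ↦ ∑ w, ∑ i, cs.titsRep w x i * cs.titsRep w y i
      conj_inner_symm := fun x y ↦ by simp [mul_comm]
      re_inner_nonneg := fun x ↦ by
        simp only [RCLike.re_to_real]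
        exact Finset.sum_nonneg fun w _ ↦ Finset.sum_nonneg fun i _ ↦ mul_self_nonneg _
      add_left := fun x y z ↦ by simp [add_mul, Finset.sum_add_distrib]
      smul_left := fun x y r ↦ by simp [mul_assoc, Finset.mul_sum]
      definite := fun x hx ↦ by
        have h₁ := (Finset.sum_eq_zero_iff_of_nonneg fun w _ ↦
          Finset.sum_nonneg fun i _ ↦ mul_self_nonneg (cs.titsRep w x i)).1 hx 1 (Finset.mem_univ _)
        have h₂ := (Finset.sum_eq_zero_iff_of_nonneg fun i _ ↦
          mul_self_nonneg (cs.titsRep 1 x i)).1 h₁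
        ext i
        simpa using h₂ i (Finset.mem_univ _) }
  let _ : NormedAddCommGroup (B →₀ ℝ) := core.toNormedAddCommGroup
  let _ : InnerProductSpace ℝ (B →₀ ℝ) := InnerProductSpace.ofCore core.toCore
  have hα : ∀ i, (Finsupp.basisSingleOne (R := ℝ) (ι := B)) i = Finsupp.single i 1 := fun i ↦ by
    simp
  refine ⟨inferInstance, inferInstance, ⟨{
    ρ := cs.titsRep
    isometry := fun w x y ↦ ?_
    α := Finsupp.basisSingleOne
    simple := fun i x ↦ ?_
    simple_self := fun i ↦ ?_
    nonneg_or_nonpos := fun w i ↦ ?_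
    exists_nonpos := fun w hw ↦ ?_ }⟩⟩
  · change ∑ v, ∑ i, cs.titsRep v (cs.titsRep w x) i * cs.titsRep v (cs.titsRep w y) i =
      ∑ v, ∑ i, cs.titsRep v x i * cs.titsRep v y i
    rw [← Equiv.sum_comp (Equiv.mulRight w) fun v ↦ ∑ i, cs.titsRep v x i * cs.titsRep v y i]
    simp
  · rw [hα, cs.titsRep_simple]
    exact ⟨M.simpleForm i x, rfl⟩
  · rw [hα, cs.titsRep_simple, M.titsReflection_single_self]
  · rw [hα]
    exact (cs.length_mul_simple w i).imp (cs.titsRep_single_nonneg w i)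
      (cs.titsRep_single_nonpos w i)
  · obtain ⟨i, hi⟩ := cs.exists_rightDescent_of_ne_one hw
    refine ⟨i, ?_⟩
    rw [hα]
    exact cs.titsRep_single_nonpos w i (cs.isRightDescent_iff.1 hi)

namespace EuclideanRealization

variable {B W : Type*} [Group W] {M : CoxeterMatrix B} {cs : CoxeterSystem M W}
  {V : Type*} [NormedAddCommGroup V] [InnerProductSpace ℝ V] (R : EuclideanRealization cs V)

theorem mul_apply (v w : W) (x : V) : R.ρ (v * w) x = R.ρ v (R.ρ w x) := by
  rw [map_mul, Module.End.mul_apply]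

theorem one_apply (x : V) : R.ρ 1 x = x := by
  rw [map_one, Module.End.one_apply]

theorem inv_apply_apply (w : W) (x : V) : R.ρ w⁻¹ (R.ρ w x) = x := by
  rw [← mul_apply, inv_mul_cancel, one_apply]

theorem apply_inv_apply (w : W) (x : V) : R.ρ w (R.ρ w⁻¹ x) = x := by
  rw [← mul_apply, mul_inv_cancel, one_apply]

theorem injective (w : W) : Function.Injective (R.ρ w) :=
  Function.LeftInverse.injective (R.inv_apply_apply w)

theorem inner_apply_left (w : W) (x y : V) : ⟪R.ρ w x, y⟫_ℝ = ⟪x, R.ρ w⁻¹ y⟫_ℝ := by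
  rw [← R.isometry w x, apply_inv_apply]

/-- `x` lies in the cone spanned by the simple roots. -/
def IsPos (x : V) : Prop := 0 ≤ R.α.repr x

/-- `β` is a root, i.e. in the orbit of a simple root. -/
def IsRoot (β : V) : Prop := ∃ w i, β = R.ρ w (R.α i)

/-- `β` is a positive root. -/
def IsPosRoot (β : V) : Prop := R.IsRoot β ∧ R.IsPos β

variable {R}

theorem IsRoot.ne_zero {β : V} (h : R.IsRoot β) : β ≠ 0 := by
  obtain ⟨w, i, rfl⟩ := h
  intro h0
  rw [← map_zero (R.ρ w)] at h0
  exact R.α.ne_zero i (R.injective w h0)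

theorem IsRoot.map {β : V} (h : R.IsRoot β) (w : W) : R.IsRoot (R.ρ w β) := by
  obtain ⟨v, i, rfl⟩ := h
  exact ⟨w * v, i, by rw [mul_apply]⟩

theorem IsRoot.neg {β : V} (h : R.IsRoot β) : R.IsRoot (-β) := by
  obtain ⟨v, i, rfl⟩ := h
  exact ⟨v * cs.simple i, i, by rw [mul_apply, R.simple_self, map_neg]⟩

theorem IsRoot.isPosRoot_or {β : V} (h : R.IsRoot β) : R.IsPosRoot β ∨ R.IsPosRoot (-β) := by
  have h' := h
  obtain ⟨v, i, rfl⟩ := h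
  refine (R.nonneg_or_nonpos v i).imp (fun hp ↦ ⟨h', hp⟩) fun hp ↦ ⟨h'.neg, ?_⟩
  rw [IsPos, map_neg]
  exact neg_nonneg.2 hp

variable (R)

theorem isRoot_simple (i : B) : R.IsRoot (R.α i) := ⟨1, i, by rw [one_apply]⟩

theorem isPosRoot_simple (i : B) : R.IsPosRoot (R.α i) :=
  ⟨R.isRoot_simple i, by simp [IsPos]⟩

theorem finite_isPosRoot [Finite W] [Finite B] : {β | R.IsPosRoot β}.Finite := by
  refine (Set.finite_range fun p : W × B ↦ R.ρ p.1 (R.α p.2)).subset ?_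
  rintro _ ⟨⟨w, i, rfl⟩, -⟩
  exact ⟨(w, i), rfl⟩

/-- `t` acts as the orthogonal reflection in the root `β`. -/
structure IsReflIn (t : W) (β : V) : Prop where
  isReflection : cs.IsReflection t
  isRoot : R.IsRoot β
  apply_eq : ∀ x, R.ρ t x = x - (2 * ⟪β, x⟫_ℝ / ⟪β, β⟫_ℝ) • β

theorem simple_apply (i : B) (x : V) :
    R.ρ (cs.simple i) x = x - (2 * ⟪R.α i, x⟫_ℝ / ⟪R.α i, R.α i⟫_ℝ) • R.α i := by
  obtain ⟨a, ha⟩ := R.simple i x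
  have h0 : ⟪R.α i, R.α i⟫_ℝ ≠ 0 := inner_self_ne_zero.2 (R.α.ne_zero i)
  have h := R.isometry (cs.simple i) (R.α i) x
  rw [R.simple_self, ha, inner_neg_left, inner_sub_right, inner_smul_right] at h
  have : a = 2 * ⟪R.α i, x⟫_ℝ / ⟪R.α i, R.α i⟫_ℝ := by
    rw [eq_div_iff h0]; linarith
  rw [ha, this]

theorem isReflIn_conj (w : W) (i : B) :
    R.IsReflIn (w * cs.simple i * w⁻¹) (R.ρ w (R.α i)) where
  isReflection := ⟨w, i, rfl⟩
  isRoot := ⟨w, i, rfl⟩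
  apply_eq x := by
    rw [mul_apply, mul_apply, simple_apply, map_sub, map_smul, apply_inv_apply,
      R.isometry, R.inner_apply_left w]

theorem isReflIn_simple (i : B) : R.IsReflIn (cs.simple i) (R.α i) where
  isReflection := cs.isReflection_simple i
  isRoot := R.isRoot_simple i
  apply_eq := R.simple_apply i

variable {R}

theorem IsRoot.exists_isReflIn {β : V} (h : R.IsRoot β) : ∃ t, R.IsReflIn t β := by
  obtain ⟨w, i, rfl⟩ := h
  exact ⟨_, R.isReflIn_conj w i⟩

variable (R)

theorem exists_isReflIn {t : W} (ht : cs.IsReflection t) : ∃ β, R.IsReflIn t β := by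
  obtain ⟨w, i, rfl⟩ := ht
  exact ⟨_, R.isReflIn_conj w i⟩

/-- The moved space of `w`, the range of `w - 1`. -/
def mov (w : W) : Submodule ℝ V := LinearMap.range (R.ρ w - 1)

/-- The fixed space of `w`. -/
def fix (w : W) : Submodule ℝ V := LinearMap.ker (R.ρ w - 1)

theorem mem_fix {w : W} {x : V} : x ∈ R.fix w ↔ R.ρ w x = x := by
  rw [fix, LinearMap.mem_ker, LinearMap.sub_apply, Module.End.one_apply, sub_eq_zero]

theorem apply_sub_mem_mov (w : W) (x : V) : R.ρ w x - x ∈ R.mov w := ⟨x, rfl⟩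

theorem mem_mov {w : W} {x : V} : x ∈ R.mov w ↔ ∃ y, R.ρ w y - y = x := Iff.rfl

section FiniteDimensional

variable [FiniteDimensional ℝ V]

theorem finrank_mov_add_finrank_fix (w : W) :
    finrank ℝ (R.mov w) + finrank ℝ (R.fix w) = finrank ℝ V :=
  LinearMap.finrank_range_add_finrank_ker _

theorem mov_eq (w : W) : R.mov w = (R.fix w)ᗮ := by
  refine Submodule.eq_of_le_of_finrank_eq ?_ ?_
  · rintro _ ⟨y, rfl⟩
    rw [Submodule.mem_orthogonal]
    intro z hz
    have hz := R.mem_fix.1 hz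
    rw [LinearMap.sub_apply, Module.End.one_apply, inner_sub_right]
    nth_rw 1 [← hz]
    rw [R.isometry, sub_self]
  · have h₁ := R.finrank_mov_add_finrank_fix w
    have h₂ := (R.fix w).finrank_add_finrank_orthogonal
    omega

theorem fix_eq (w : W) : R.fix w = (R.mov w)ᗮ := by
  rw [mov_eq, Submodule.orthogonal_orthogonal]

theorem mem_mov_iff {w : W} {x : V} : x ∈ R.mov w ↔ ∀ z, R.ρ w z = z → ⟪z, x⟫_ℝ = 0 := by
  rw [mov_eq, Submodule.mem_orthogonal]
  simp [mem_fix]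

theorem mov_inv (w : W) : R.mov w⁻¹ = R.mov w := by
  have : R.fix w⁻¹ = R.fix w := by
    ext x
    rw [mem_fix, mem_fix]
    constructor <;> intro h
    · nth_rw 1 [← h]; exact R.apply_inv_apply w x
    · nth_rw 1 [← h]; exact R.inv_apply_apply w x
  rw [mov_eq, mov_eq, this]

omit [FiniteDimensional ℝ V] in
theorem mov_mul_le (v w : W) : R.mov (v * w) ≤ R.mov v ⊔ R.mov w := by
  rintro _ ⟨y, rfl⟩
  have : (R.ρ (v * w) - 1) y = (R.ρ v (R.ρ w y) - R.ρ w y) + (R.ρ w y - y) := by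
    rw [LinearMap.sub_apply, mul_apply, Module.End.one_apply]; abel
  rw [this]
  exact Submodule.add_mem_sup (R.apply_sub_mem_mov v _) (R.apply_sub_mem_mov w y)

theorem finrank_mov_mul_le (v w : W) :
    finrank ℝ (R.mov (v * w)) ≤ finrank ℝ (R.mov v) + finrank ℝ (R.mov w) :=
  (Submodule.finrank_mono (R.mov_mul_le v w)).trans (Submodule.finrank_add_le_finrank_add_finrank _ _)

omit [FiniteDimensional ℝ V] in
theorem mem_mov_conj {g w : W} {x : V} : x ∈ R.mov (g * w * g⁻¹) ↔ R.ρ g⁻¹ x ∈ R.mov w := by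
  rw [mem_mov, mem_mov]
  constructor
  · rintro ⟨y, rfl⟩
    exact ⟨R.ρ g⁻¹ y, by rw [map_sub, mul_apply, mul_apply, inv_apply_apply]⟩
  · rintro ⟨y, hy⟩
    refine ⟨R.ρ g y, ?_⟩
    rw [mul_apply, mul_apply, inv_apply_apply, ← map_sub, hy, apply_inv_apply]

omit [FiniteDimensional ℝ V] in
theorem mov_one : R.mov 1 = ⊥ := by simp [mov]

omit [FiniteDimensional ℝ V] in
variable {R} in
theorem IsReflIn.apply_self {t : W} {β : V} (h : R.IsReflIn t β) : R.ρ t β = -β := by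
  have h0 : ⟪β, β⟫_ℝ ≠ 0 := inner_self_ne_zero.2 h.isRoot.ne_zero
  rw [h.apply_eq, mul_div_assoc, div_self h0]
  module

omit [FiniteDimensional ℝ V] in
variable {R} in
theorem IsReflIn.mov_eq {t : W} {β : V} (h : R.IsReflIn t β) : R.mov t = Submodule.span ℝ {β} := by
  refine le_antisymm ?_ ?_
  · rintro _ ⟨y, rfl⟩
    rw [LinearMap.sub_apply, Module.End.one_apply, h.apply_eq, Submodule.mem_span_singleton]
    exact ⟨-(2 * ⟪β, y⟫_ℝ / ⟪β, β⟫_ℝ), by module⟩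
  · rw [Submodule.span_singleton_le_iff_mem]
    refine ⟨-(1 / 2 : ℝ) • β, ?_⟩
    rw [LinearMap.sub_apply, Module.End.one_apply, map_smul, h.apply_self]
    module

omit [FiniteDimensional ℝ V] in
variable {R} in
theorem IsReflIn.finrank_mov {t : W} {β : V} (h : R.IsReflIn t β) : finrank ℝ (R.mov t) = 1 := by
  rw [h.mov_eq, finrank_span_singleton h.isRoot.ne_zero]

variable {R}

/-- Carter's lemma: multiplying by a reflection whose root is moved by `w` cuts the moved space
down by one dimension. -/
theorem IsReflIn.finrank_mov_mul {t w : W} {β : V} (h : R.IsReflIn t β) (hβ : β ∈ R.mov w) :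
    finrank ℝ (R.mov (t * w)) + 1 = finrank ℝ (R.mov w) := by
  have htt : t * t = 1 := h.isReflection.mul_self
  have hle : finrank ℝ (R.mov w) ≤ 1 + finrank ℝ (R.mov (t * w)) := by
    have := R.finrank_mov_mul_le t (t * w)
    rwa [← mul_assoc, htt, one_mul, h.finrank_mov] at this
  have hfix : R.fix w < R.fix (t * w) := by
    refine lt_of_le_of_ne (fun z hz ↦ ?_) fun heq ↦ ?_
    · rw [mem_fix] at hz ⊢
      rw [mul_apply, hz, h.apply_eq, real_inner_comm, R.mem_mov_iff.1 hβ z hz]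
      simp
    · obtain ⟨y, hy⟩ := R.mem_mov.1 hβ
      have hwy : R.ρ w y = y + β := by rw [← hy]; abel
      have hn := R.isometry w y y
      rw [hwy, inner_add_left, inner_add_right, inner_add_right, real_inner_comm β y] at hn
      have h0 : ⟪β, β⟫_ℝ ≠ 0 := inner_self_ne_zero.2 h.isRoot.ne_zero
      have hy' : y ∈ R.fix (t * w) := by
        have : 2 * ⟪β, y + β⟫_ℝ / ⟪β, β⟫_ℝ = 1 := by
          rw [div_eq_one_iff_eq h0, inner_add_right]; linarith
        rw [mem_fix, mul_apply, hwy, h.apply_eq, this]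
        module
      rw [← heq, mem_fix, hwy] at hy'
      exact h.isRoot.ne_zero (by simpa using hy')
  have h₁ := Submodule.finrank_lt_finrank_of_lt hfix
  have h₂ := R.finrank_mov_add_finrank_fix w
  have h₃ := R.finrank_mov_add_finrank_fix (t * w)
  omega

omit [FiniteDimensional ℝ V] in
theorem IsReflIn.mov_mul_le {t w : W} {β : V} (h : R.IsReflIn t β) (hβ : β ∈ R.mov w) :
    R.mov (t * w) ≤ R.mov w := by
  refine (R.mov_mul_le t w).trans (sup_le ?_ le_rfl)
  rwa [h.mov_eq, Submodule.span_singleton_le_iff_mem]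

omit [FiniteDimensional ℝ V] in
theorem IsReflIn.mov_eq_sup {t w : W} {β : V} (h : R.IsReflIn t β) (hβ : β ∈ R.mov w) :
    R.mov w = Submodule.span ℝ {β} ⊔ R.mov (t * w) := by
  refine le_antisymm ?_ (sup_le ?_ (h.mov_mul_le hβ))
  · have := R.mov_mul_le t (t * w)
    rwa [← mul_assoc, h.isReflection.mul_self, one_mul, h.mov_eq] at this
  · rwa [Submodule.span_singleton_le_iff_mem]

variable (R)

/-- The sum of the coordinates with respect to the simple roots. -/
noncomputable def height [Fintype B] : V →ₗ[ℝ] ℝ :=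
  ∑ i, R.α.coord i

omit [FiniteDimensional ℝ V] in
theorem height_simple [Fintype B] (i : B) : R.height (R.α i) = 1 := by
  classical
  simp [height, Finsupp.single_apply]

omit [FiniteDimensional ℝ V] in
theorem eq_one_of_fixes_dominant [Fintype B] {w : W} {x : V} (hx : ∀ i, 0 < ⟪R.α i, x⟫_ℝ)
    (hw : R.ρ w x = x) : w = 1 := by
  by_contra hne
  obtain ⟨i, hi⟩ := R.exists_nonpos w hne
  have h : ⟪R.ρ w (R.α i), x⟫_ℝ = ⟪R.α i, x⟫_ℝ := by
    nth_rw 1 [← hw]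
    exact R.isometry _ _ _
  have h' : ⟪R.ρ w (R.α i), x⟫_ℝ ≤ 0 := by
    rw [← R.α.sum_repr (R.ρ w (R.α i)), sum_inner]
    refine Finset.sum_nonpos fun j _ ↦ ?_
    rw [real_inner_smul_left]
    exact mul_nonpos_of_nonpos_of_nonneg (hi j) (hx j).le
  have := hx i
  linarith

omit [FiniteDimensional ℝ V] in
theorem eq_one_of_fixes_regular [Finite W] [Fintype B] {w : W} {x : V}
    (hx : ∀ β, R.IsRoot β → ⟪β, x⟫_ℝ ≠ 0) (hw : R.ρ w x = x) : w = 1 := by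
  obtain ⟨g, hg⟩ := Finite.exists_max fun g ↦ R.height (R.ρ g x)
  have hdom : ∀ i, 0 < ⟪R.α i, R.ρ g x⟫_ℝ := by
    intro i
    have hne : ⟪R.α i, R.ρ g x⟫_ℝ ≠ 0 := by
      rw [real_inner_comm, R.inner_apply_left, real_inner_comm]
      exact hx _ ((R.isRoot_simple i).map _)
    have h := hg (cs.simple i * g)
    simp only [mul_apply] at h
    rw [R.simple_apply, map_sub, map_smul, R.height_simple, smul_eq_mul, mul_one] at h
    have h0 : 0 < ⟪R.α i, R.α i⟫_ℝ := real_inner_self_pos.2 (R.α.ne_zero i)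
    have h' : 0 ≤ 2 * ⟪R.α i, R.ρ g x⟫_ℝ / ⟪R.α i, R.α i⟫_ℝ := by linarith
    rw [le_div_iff₀ h0] at h'
    exact lt_of_le_of_ne (by linarith) hne.symm
  have := R.eq_one_of_fixes_dominant (w := g * w * g⁻¹) hdom
    (by rw [mul_apply, mul_apply, inv_apply_apply, hw])
  simpa using this

theorem exists_isRoot_mem_mov [Finite W] [Finite B] {w : W} (hw : w ≠ 1) :
    ∃ β, R.IsRoot β ∧ β ∈ R.mov w := by
  have : Fintype B := Fintype.ofFinite B
  by_contra! hcon
  obtain ⟨y, hy, hy'⟩ := Module.Dual.exists_forall_mem_ne_zero_of_forall_exists (R.fix w)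
    (fun p : W × B ↦ innerₗ V (R.ρ p.1 (R.α p.2))) fun p ↦ by
      by_contra! h
      refine hcon _ ⟨p.1, p.2, rfl⟩ (R.mem_mov_iff.2 fun z hz ↦ ?_)
      rw [real_inner_comm]
      simpa using h z (R.mem_fix.2 hz)
  refine hw (R.eq_one_of_fixes_regular (x := y) ?_ (R.mem_fix.1 hy))
  rintro _ ⟨v, i, rfl⟩
  simpa using hy' (v, i)

theorem finrank_mov_prod_le (l : List W) (hl : ∀ t ∈ l, cs.IsReflection t) :
    finrank ℝ (R.mov l.prod) ≤ l.length := by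
  induction l with
  | nil => rw [List.prod_nil, mov_one]; simp
  | cons t l ih =>
    obtain ⟨β, hβ⟩ := R.exists_isReflIn (hl t (by simp))
    have h₁ := R.finrank_mov_mul_le t l.prod
    have h₂ := ih fun t ht ↦ hl t (by simp [ht])
    rw [hβ.finrank_mov] at h₁
    rw [List.prod_cons, List.length_cons]
    omega

theorem exists_list_prod_eq [Finite W] [Finite B] (w : W) :
    ∃ l : List W, l.length = finrank ℝ (R.mov w) ∧ (∀ t ∈ l, cs.IsReflection t) ∧ l.prod = w := by
  induction hn : finrank ℝ (R.mov w) using Nat.strong_induction_on generalizing w with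
  | _ n ih =>
  by_cases hw : w = 1
  · subst hw
    rw [mov_one, finrank_bot] at hn
    exact ⟨[], by simpa using hn, by simp, by simp⟩
  obtain ⟨β, hβ, hmem⟩ := R.exists_isRoot_mem_mov hw
  obtain ⟨t, ht⟩ := hβ.exists_isReflIn
  have h := ht.finrank_mov_mul hmem
  obtain ⟨l, h₁, h₂, h₃⟩ := ih _ (by omega) (t * w) rfl
  refine ⟨t :: l, by simp; omega, ?_, ?_⟩
  · rintro t' ht'
    rcases List.mem_cons.1 ht' with rfl | ht'
    exacts [ht.isReflection, h₂ _ ht']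
  · rw [List.prod_cons, h₃, ← mul_assoc, ht.isReflection.mul_self, one_mul]

theorem reflLen_eq [Finite W] [Finite B] (w : W) : reflLen cs w = finrank ℝ (R.mov w) := by
  refine le_antisymm (Nat.sInf_le (R.exists_list_prod_eq w)) ?_
  refine le_csInf ⟨_, R.exists_list_prod_eq w⟩ ?_
  rintro _ ⟨l, rfl, hl, rfl⟩
  exact R.finrank_mov_prod_le l hl

/-- The moved space is spanned by the roots it contains. -/
theorem span_isRoot_mem_mov [Finite W] [Finite B] (w : W) :
    Submodule.span ℝ {β | R.IsPosRoot β ∧ β ∈ R.mov w} = R.mov w := by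
  refine le_antisymm (Submodule.span_le.2 fun β hβ ↦ hβ.2) ?_
  induction hn : finrank ℝ (R.mov w) using Nat.strong_induction_on generalizing w with
  | _ n ih =>
  by_cases hw : w = 1
  · subst hw
    rw [mov_one]
    exact bot_le
  obtain ⟨β, hβ, hmem⟩ := R.exists_isRoot_mem_mov hw
  obtain ⟨t, ht⟩ := hβ.exists_isReflIn
  have h := ht.finrank_mov_mul hmem
  have hmem' : β ∈ Submodule.span ℝ {β | R.IsPosRoot β ∧ β ∈ R.mov w} := by
    rcases hβ.isPosRoot_or with hp | hp
    · exact Submodule.subset_span ⟨hp, hmem⟩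
    · rw [← neg_neg β]
      exact neg_mem (Submodule.subset_span ⟨hp, neg_mem hmem⟩)
  calc R.mov w = Submodule.span ℝ {β} ⊔ R.mov (t * w) := ht.mov_eq_sup hmem
    _ ≤ _ := by
      refine sup_le (by rwa [Submodule.span_singleton_le_iff_mem]) ?_
      refine (ih _ (by omega) (t * w) rfl).trans (Submodule.span_mono ?_)
      exact fun β hβ ↦ ⟨hβ.1, ht.mov_mul_le hmem hβ.2⟩

end FiniteDimensional

end EuclideanRealization

namespace EuclideanRealization

variable {B W : Type*} [Group W] {M : CoxeterMatrix B} {cs : CoxeterSystem M W}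
  {V : Type*} [NormedAddCommGroup V] [InnerProductSpace ℝ V] {R : EuclideanRealization cs V}

theorem isPos_iff {x : V} : R.IsPos x ↔ ∀ i, 0 ≤ R.α.coord i x := Iff.rfl

theorem IsPos.add {x y : V} (hx : R.IsPos x) (hy : R.IsPos y) : R.IsPos (x + y) := by
  rw [IsPos, map_add]
  exact add_nonneg hx hy

theorem IsPos.smul {x : V} (hx : R.IsPos x) {a : ℝ} (ha : 0 ≤ a) : R.IsPos (a • x) := by
  rw [isPos_iff] at hx ⊢
  intro i
  rw [map_smul]
  exact mul_nonneg ha (hx i)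

theorem isPos_zero : R.IsPos 0 := by simp [IsPos]

theorem IsPos.eq_zero {x : V} (hx : R.IsPos x) (hx' : R.IsPos (-x)) : x = 0 := by
  rw [IsPos, map_neg, neg_nonneg] at hx'
  rw [← R.α.repr.map_eq_zero_iff]
  exact le_antisymm hx' hx

theorem IsPos.eq_zero_of_add {x y : V} (hx : R.IsPos x) (hy : R.IsPos y) (h : x + y = 0) :
    x = 0 :=
  hx.eq_zero (by rwa [← eq_neg_of_add_eq_zero_right h])

theorem IsPosRoot.height_pos [Fintype B] {β : V} (hβ : R.IsPosRoot β) : 0 < R.height β := by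
  have h0 : ∀ i, 0 ≤ R.α.coord i β := isPos_iff.1 hβ.2
  rw [height, LinearMap.sum_apply]
  refine (Finset.sum_nonneg fun i _ ↦ h0 i).lt_of_ne fun h ↦ hβ.1.ne_zero ?_
  have := (Finset.sum_eq_zero_iff_of_nonneg fun i _ ↦ h0 i).1 h.symm
  exact R.α.ext_elem fun i ↦ by simpa using this i (Finset.mem_univ i)

variable (R)

/-- The cone spanned by the positive roots in `U`. -/
def posCone (U : Submodule ℝ V) : PointedCone ℝ V :=
  PointedCone.hull ℝ {β | R.IsPosRoot β ∧ β ∈ U}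

variable {R} {U U' : Submodule ℝ V}

theorem IsPosRoot.mem_posCone {β : V} (h : R.IsPosRoot β) (hU : β ∈ U) : β ∈ R.posCone U :=
  PointedCone.subset_hull ⟨h, hU⟩

theorem posCone_mono (h : U ≤ U') : R.posCone U ≤ R.posCone U' :=
  Submodule.span_mono fun _ hβ ↦ ⟨hβ.1, h hβ.2⟩

theorem isPos_of_mem_hull {s : Set V} (hs : ∀ β ∈ s, R.IsPos β) {x : V}
    (hx : x ∈ PointedCone.hull ℝ s) : R.IsPos x := by
  induction hx using Submodule.span_induction with
  | mem x h => exact hs x h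
  | zero => exact isPos_zero
  | add x y _ _ hx hy => exact hx.add hy
  | smul a x _ hx => exact hx.smul a.2

theorem isPos_of_mem_posCone {x : V} (hx : x ∈ R.posCone U) : R.IsPos x :=
  isPos_of_mem_hull (fun _ h ↦ h.1.2) hx

theorem mem_of_mem_posCone {x : V} (hx : x ∈ R.posCone U) : x ∈ U := by
  have h := PointedCone.hull_le_span ℝ _ hx
  exact Submodule.span_le.2 (fun _ hβ ↦ hβ.2) h

variable (R)

/-- The positive roots in a subspace span a simplicial cone, generated by finitely many of them. -/
theorem exists_simple_roots [Finite W] [Finite B] (U : Submodule ℝ V) :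
    ∃ Γ : Set V, (∀ γ ∈ Γ, R.IsPosRoot γ ∧ γ ∈ U) ∧ LinearIndepOn ℝ id Γ ∧
      R.posCone U = PointedCone.hull ℝ Γ := by
  classical
  have : Fintype B := Fintype.ofFinite B
  have hfin : {β | R.IsPosRoot β ∧ β ∈ U}.Finite := R.finite_isPosRoot.subset fun _ h ↦ h.1
  obtain ⟨Γ, ⟨hΓU, hΓ⟩, hmin⟩ := exists_minimal_of_wellFoundedLT
    (fun Γ : Finset V ↦ (∀ γ ∈ Γ, R.IsPosRoot γ ∧ γ ∈ U) ∧
      R.posCone U ≤ PointedCone.hull ℝ (Γ : Set V))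
    ⟨hfin.toFinset, fun γ hγ ↦ hfin.mem_toFinset.1 hγ, by rw [hfin.coe_toFinset]; exact le_rfl⟩
  have hirr : ∀ γ ∈ Γ, γ ∉ PointedCone.hull ℝ ((Γ.erase γ : Finset V) : Set V) := by
    intro γ hγ hmem
    refine Finset.notMem_erase γ Γ (hmin ⟨fun δ hδ ↦ hΓU δ (Finset.mem_of_mem_erase hδ),
      hΓ.trans (Submodule.span_le.2 fun δ hδ ↦ ?_)⟩ (Finset.erase_subset γ Γ) hγ)
    by_cases h : δ = γ
    · exact h ▸ hmem
    · exact Submodule.subset_span (Finset.mem_coe.2 (Finset.mem_erase.2 ⟨h, hδ⟩))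
  have key : ∀ γ ∈ Γ, ∀ z ∈ PointedCone.hull ℝ ((Γ.erase γ : Finset V) : Set V), z ≠ 0 →
      ∀ b : ℝ, ¬ R.IsPosRoot (b • γ - z) ∨ b • γ - z ∉ U := by
    intro γ hγ z hz hz0 b
    by_contra! hmem
    have hmem' := hΓ (hmem.1.mem_posCone hmem.2)
    rw [← Finset.insert_erase hγ, Finset.coe_insert, PointedCone.hull,
      Submodule.mem_span_insert] at hmem'
    obtain ⟨a, y, hy, hay⟩ := hmem'
    have hpos : ∀ w ∈ PointedCone.hull ℝ ((Γ.erase γ : Finset V) : Set V), R.IsPos w :=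
      fun w hw ↦ isPos_of_mem_hull (fun β hβ ↦ (hΓU β (Finset.mem_of_mem_erase hβ)).1.2) hw
    have hay' : b • γ - z = (a : ℝ) • γ + y := hay
    have hsum : (b - a) • γ = z + y := by linear_combination (norm := module) hay'
    rcases lt_or_ge (a : ℝ) b with hab | hab
    · have hγ' : γ = (b - a)⁻¹ • (z + y) := by
        rw [← hsum, smul_smul, inv_mul_cancel₀ (sub_pos.2 hab).ne', one_smul]
      have hmem := PointedCone.smul_mem _ (inv_nonneg.2 (sub_pos.2 hab).le) (add_mem hz hy)
      rw [← hγ'] at hmem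
      exact hirr γ hγ hmem
    · refine hz0 ((hpos z hz).eq_zero_of_add
        ((hpos y hy).add ((hΓU γ hγ).1.2.smul (sub_nonneg.2 hab))) ?_)
      linear_combination (norm := module) -hsum
  refine ⟨Γ, hΓU, ?_, le_antisymm hΓ (Submodule.span_mono fun γ hγ ↦ hΓU γ hγ)⟩
  refine LinearMap.BilinForm.linearIndependent_of_pairwise_le_zero (innerₗ V) ?_ R.height
    (fun γ : (Γ : Set V) ↦ id γ.1) (fun γ ↦ (hΓU γ γ.2).1.height_pos) ?_
  · intro x hx
    exact real_inner_self_pos.2 hx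
  · rintro ⟨γ, hγ⟩ ⟨δ, hδ⟩ hne
    by_contra! hpos
    replace hpos : 0 < ⟪γ, δ⟫_ℝ := hpos
    replace hne : γ ≠ δ := fun h ↦ hne (Subtype.ext h)
    have hγγ : 0 < ⟪γ, γ⟫_ℝ := real_inner_self_pos.2 (hΓU γ hγ).1.1.ne_zero
    obtain ⟨t, ht⟩ := (hΓU γ hγ).1.1.exists_isReflIn
    set k := 2 * ⟪γ, δ⟫_ℝ / ⟪γ, γ⟫_ℝ with hk
    have hk0 : 0 < k := by positivity
    have hroot : R.IsRoot (δ - k • γ) := by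
      rw [← ht.apply_eq]
      exact (hΓU δ hδ).1.1.map t
    have hU : δ - k • γ ∈ U := sub_mem (hΓU δ hδ).2 (U.smul_mem _ (hΓU γ hγ).2)
    have hγ' : γ ∈ PointedCone.hull ℝ ((Γ.erase δ : Finset V) : Set V) :=
      Submodule.subset_span (Finset.mem_coe.2 (Finset.mem_erase.2 ⟨hne, hγ⟩))
    have hδ' : δ ∈ PointedCone.hull ℝ ((Γ.erase γ : Finset V) : Set V) :=
      Submodule.subset_span (Finset.mem_coe.2 (Finset.mem_erase.2 ⟨hne.symm, hδ⟩))
    rcases hroot.isPosRoot_or with h | h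
    · rcases key δ hδ (k • γ) (PointedCone.smul_mem _ hk0.le hγ')
        (smul_ne_zero hk0.ne' (hΓU γ hγ).1.1.ne_zero) 1 with h' | h' <;> rw [one_smul] at h'
      exacts [h' h, h' hU]
    · rw [neg_sub] at h
      rcases key γ hγ δ hδ' (hΓU δ hδ).1.1.ne_zero k with h' | h'
      · exact h' h
      · exact h' (by rw [← neg_sub]; exact neg_mem hU)

variable {R} in
/-- If the simple root `α i` lies in `U`, then the cone of positive roots of `U` is the product of
the ray of `α i` and a face, provided `U ∩ ker αᵢ*` is spanned by its roots. -/
theorem mem_posCone_iff [Finite W] [Finite B] {i : B} (hi : R.α i ∈ U)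
    (hle : U' ≤ U) (hU' : ∀ x, x ∈ U' ↔ x ∈ U ∧ R.α.coord i x = 0)
    (hspan : U' ≤ Submodule.span ℝ {β | R.IsPosRoot β ∧ β ∈ U'}) {x : V} :
    x ∈ R.posCone U ↔ 0 ≤ R.α.coord i x ∧ x - R.α.coord i x • R.α i ∈ R.posCone U' := by
  refine ⟨fun hx ↦ ⟨isPos_iff.1 (isPos_of_mem_posCone hx) i, ?_⟩, fun ⟨h, h'⟩ ↦ ?_⟩
  swap
  · rw [← sub_add_cancel x (R.α.coord i x • R.α i)]
    exact add_mem (posCone_mono hle h')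
      (PointedCone.smul_mem _ h ((R.isPosRoot_simple i).mem_posCone hi))
  obtain ⟨Γ, hΓU, hΓ, hcone⟩ := R.exists_simple_roots U
  set φ := R.α.coord i with hφ
  have hφi : φ (R.α i) = 1 := by simp [hφ]
  have hΓφ : ∀ γ ∈ Γ, 0 ≤ φ γ := fun γ hγ ↦ isPos_iff.1 (hΓU γ hγ).1.2 i
  have hface : ∀ y ∈ PointedCone.hull ℝ Γ,
      0 ≤ φ y ∧ (φ y = 0 → y ∈ Submodule.span ℝ {γ ∈ Γ | φ γ = 0}) := by
    intro y hy
    induction hy using Submodule.span_induction with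
    | mem γ h => exact ⟨hΓφ γ h, fun h0 ↦ Submodule.subset_span ⟨h, h0⟩⟩
    | zero => simp
    | add y z _ _ hy hz =>
      rw [map_add]
      refine ⟨add_nonneg hy.1 hz.1, fun h ↦ ?_⟩
      rw [add_eq_zero_iff_of_nonneg hy.1 hz.1] at h
      exact add_mem (hy.2 h.1) (hz.2 h.2)
    | smul a y _ hy =>
      change 0 ≤ φ ((a : ℝ) • y) ∧ (φ ((a : ℝ) • y) = 0 → (a : ℝ) • y ∈ _)
      rw [map_smul, smul_eq_mul]
      refine ⟨mul_nonneg a.2 hy.1, fun h ↦ ?_⟩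
      rcases mul_eq_zero.1 h with h | h
      · rw [h, zero_smul]; exact zero_mem _
      · exact Submodule.smul_mem _ _ (hy.2 h)
  have hU'span : U' ≤ Submodule.span ℝ {γ ∈ Γ | φ γ = 0} := by
    refine hspan.trans (Submodule.span_le.2 fun β hβ ↦ (hface β ?_).2 ((hU' β).1 hβ.2).2)
    rw [← hcone]
    exact hβ.1.mem_posCone (hle hβ.2)
  have hαΓ : R.α i ∈ PointedCone.hull ℝ Γ :=
    hcone ▸ (R.isPosRoot_simple i).mem_posCone hi
  have hprop : ∀ γ ∈ Γ, φ γ ≠ 0 → γ - φ γ • R.α i = 0 := by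
    intro γ hγ hγ0
    have hsub : Submodule.span ℝ {γ ∈ Γ | φ γ = 0} ≤ Submodule.span ℝ (Γ \ {γ}) :=
      Submodule.span_mono fun δ hδ ↦ ⟨hδ.1, fun h ↦ hγ0 (h ▸ hδ.2)⟩
    have hnot : γ ∉ Submodule.span ℝ (Γ \ {γ}) := by
      simpa using hΓ.notMem_span hγ
    have hα := hαΓ
    rw [← Set.insert_sdiff_self_of_mem hγ, PointedCone.hull, Submodule.mem_span_insert] at hα
    obtain ⟨a, y, hy, hay⟩ := hα
    replace hay : R.α i = (a : ℝ) • γ + y := hay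
    have hyspan : y ∈ Submodule.span ℝ (Γ \ {γ}) := PointedCone.hull_le_span ℝ _ hy
    have hypos : R.IsPos y := isPos_of_mem_hull (fun β hβ ↦ (hΓU β hβ.1).1.2) hy
    have hmem : γ - φ γ • R.α i ∈ Submodule.span ℝ (Γ \ {γ}) := by
      refine hsub (hU'span ((hU' _).2 ⟨sub_mem (hΓU γ hγ).2 (U.smul_mem _ hi), ?_⟩))
      rw [map_sub, map_smul, hφi, smul_eq_mul, mul_one, sub_self]
    have haφ : φ γ * a = 1 := by
      by_contra hne
      have hne' : 1 - φ γ * a ≠ 0 := sub_ne_zero.2 (Ne.symm hne)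
      have h1 : (1 - φ γ * a) • γ ∈ Submodule.span ℝ (Γ \ {γ}) := by
        convert add_mem hmem (Submodule.smul_mem _ (φ γ) hyspan) using 1
        rw [hay]
        module
      exact hnot ((Submodule.smul_mem_iff _ hne').1 h1)
    have ha : 0 < (a : ℝ) := by
      refine lt_of_le_of_ne a.2 fun h ↦ ?_
      rw [← h, mul_zero] at haφ
      exact zero_ne_one haφ
    refine R.α.ext_elem fun j ↦ ?_
    rw [map_zero, Finsupp.zero_apply, map_sub, map_smul, Finsupp.sub_apply, Finsupp.smul_apply,
      R.α.repr_self, smul_eq_mul]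
    by_cases hj : j = i
    · subst hj
      rw [Finsupp.single_eq_same, mul_one]
      exact sub_self _
    · rw [Finsupp.single_eq_of_ne hj, mul_zero, sub_zero]
      have hj' := congrArg (R.α.coord j) hay
      rw [map_add, map_smul, Basis.coord_apply, R.α.repr_self, Finsupp.single_eq_of_ne hj,
        smul_eq_mul] at hj'
      have h1 := isPos_iff.1 (hΓU γ hγ).1.2 j
      have h2 := isPos_iff.1 hypos j
      have h3 := mul_nonneg ha.le h1
      have h4 : (a : ℝ) * R.α.coord j γ = 0 := by linarith
      exact (mul_eq_zero.1 h4).resolve_left ha.ne'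
  rw [hcone] at hx
  induction hx using Submodule.span_induction with
  | mem γ h =>
    by_cases h0 : φ γ = 0
    · rw [h0, zero_smul, sub_zero]
      exact (hΓU γ h).1.mem_posCone ((hU' _).2 ⟨(hΓU γ h).2, h0⟩)
    · rw [hprop γ h h0]; exact zero_mem _
  | zero => simp
  | add y z _ _ hy hz =>
    convert add_mem hy hz using 1
    rw [map_add]; module
  | smul a y _ hy =>
    convert PointedCone.smul_mem _ a.2 hy using 1
    change (a : ℝ) • y - φ ((a : ℝ) • y) • R.α i = (a : ℝ) • (y - φ y • R.α i)
    rw [map_smul, smul_eq_mul]; module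

end EuclideanRealization

namespace EuclideanRealization

variable {B W : Type*} [Group W] {M : CoxeterMatrix B} {cs : CoxeterSystem M W}
  {V : Type*} [NormedAddCommGroup V] [InnerProductSpace ℝ V] (R : EuclideanRealization cs V)
  {U U' : Submodule ℝ V}

theorem simple_apply_simple_apply (i : B) (x : V) :
    R.ρ (cs.simple i) (R.ρ (cs.simple i) x) = x := by
  rw [← mul_apply, cs.simple_mul_simple_self, one_apply]

theorem coord_simple_apply {i j : B} (h : j ≠ i) (x : V) :
    R.α.coord j (R.ρ (cs.simple i) x) = R.α.coord j x := by
  rw [simple_apply, map_sub, map_smul, Basis.coord_apply _ _ (R.α i), R.α.repr_self,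
    Finsupp.single_eq_of_ne h, smul_zero, sub_zero]

theorem simple_mem_of_mem {i : B} (hi : R.α i ∈ U) {x : V} (hx : x ∈ U) :
    R.ρ (cs.simple i) x ∈ U := by
  rw [simple_apply]
  exact sub_mem hx (U.smul_mem _ hi)

variable {R}

theorem IsPosRoot.simple_apply {i : B} {β : V} (hβ : R.IsPosRoot β) (hβU : β ∈ U)
    (hi : R.α i ∉ U) : R.IsPosRoot (R.ρ (cs.simple i) β) := by
  rcases (hβ.1.map (cs.simple i)).isPosRoot_or with h | h
  · exact h
  exfalso
  have hβi : β = R.α.coord i β • R.α i := by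
    refine R.α.ext_elem fun j ↦ ?_
    rw [map_smul, R.α.repr_self, Finsupp.smul_apply, smul_eq_mul]
    by_cases hj : j = i
    · subst hj
      rw [Finsupp.single_eq_same, mul_one, Basis.coord_apply]
    · rw [Finsupp.single_eq_of_ne hj, mul_zero]
      have h1 := isPos_iff.1 h.2 j
      rw [map_neg, R.coord_simple_apply hj] at h1
      exact le_antisymm (neg_nonneg.1 h1) (isPos_iff.1 hβ.2 j)
  have h0 : R.α.coord i β ≠ 0 := by
    intro h0
    rw [h0, zero_smul] at hβi
    exact hβ.1.ne_zero hβi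
  rw [hβi] at hβU
  exact hi ((U.smul_mem_iff h0).1 hβU)

theorem simple_apply_mem_posCone {i : B} (hi : R.α i ∉ U) {x : V} (hx : x ∈ R.posCone U) :
    R.ρ (cs.simple i) x ∈ R.posCone (U.map (R.ρ (cs.simple i))) := by
  induction hx using Submodule.span_induction with
  | mem β h =>
    exact (h.1.simple_apply h.2 hi).mem_posCone (Submodule.mem_map_of_mem h.2)
  | zero => rw [map_zero]; exact zero_mem _
  | add x y _ _ hx hy => rw [map_add]; exact add_mem hx hy
  | smul a x _ hx =>
    have h : R.ρ (cs.simple i) (a • x) = (a : ℝ) • R.ρ (cs.simple i) x := map_smul _ (a : ℝ) x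
    rw [h]
    exact PointedCone.smul_mem _ a.2 hx

variable (R)

theorem map_simple_map_simple (i : B) (U : Submodule ℝ V) :
    (U.map (R.ρ (cs.simple i))).map (R.ρ (cs.simple i)) = U := by
  rw [← Submodule.map_comp, ← Module.End.mul_eq_comp, ← map_mul, cs.simple_mul_simple_self,
    map_one, Module.End.one_eq_id, Submodule.map_id]

theorem map_simple_eq_of_mem {i : B} (hi : R.α i ∈ U) : U.map (R.ρ (cs.simple i)) = U := by
  refine le_antisymm (Submodule.map_le_iff_le_comap.2 fun x hx ↦ R.simple_mem_of_mem hi hx) ?_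
  exact fun x hx ↦ ⟨_, R.simple_mem_of_mem hi hx, R.simple_apply_simple_apply i x⟩

theorem simple_mem_map_simple_iff {i : B} :
    R.α i ∈ U.map (R.ρ (cs.simple i)) ↔ R.α i ∈ U := by
  constructor <;> intro h
  · rw [← R.map_simple_map_simple i U, R.map_simple_eq_of_mem h]
    exact h
  · rwa [R.map_simple_eq_of_mem h]

theorem mov_conj (g w : W) : R.mov (g * w * g⁻¹) = (R.mov w).map (R.ρ g) := by
  ext x
  rw [mem_mov_conj, Submodule.mem_map]
  constructor
  · exact fun h ↦ ⟨_, h, R.apply_inv_apply g x⟩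
  · rintro ⟨y, hy, rfl⟩
    rwa [inv_apply_apply]

theorem mov_simple_conj (i : B) (w : W) :
    R.mov (cs.simple i * w * cs.simple i) = (R.mov w).map (R.ρ (cs.simple i)) := by
  rw [← mov_conj, cs.inv_simple]

theorem finrank_mov_conj (g w : W) : finrank ℝ (R.mov (g * w * g⁻¹)) = finrank ℝ (R.mov w) := by
  rw [mov_conj]
  exact (Submodule.equivMapOfInjective _ (R.injective g) _).finrank_eq.symm

section FiniteDimensional

variable [FiniteDimensional ℝ V] [Finite W] [Finite B]

include R

theorem absLe_iff {u v : W} : absLe cs u v ↔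
    finrank ℝ (R.mov u) + finrank ℝ (R.mov (u⁻¹ * v)) = finrank ℝ (R.mov v) := by
  rw [absLe, R.reflLen_eq, R.reflLen_eq, R.reflLen_eq]

theorem absLe_conj {u v : W} (h : absLe cs u v) (g : W) :
    absLe cs (g * u * g⁻¹) (g * v * g⁻¹) := by
  rw [R.absLe_iff] at h ⊢
  have : (g * u * g⁻¹)⁻¹ * (g * v * g⁻¹) = g * (u⁻¹ * v) * g⁻¹ := by group
  rw [this, finrank_mov_conj, finrank_mov_conj, finrank_mov_conj, h]

theorem one_absLe (v : W) : absLe cs 1 v := by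
  rw [R.absLe_iff, mov_one, inv_one, one_mul, finrank_bot, zero_add]

theorem mov_le_of_absLe {u v : W} (h : absLe cs u v) : R.mov u ≤ R.mov v := by
  rw [R.absLe_iff] at h
  have h1 : R.mov v ≤ R.mov u ⊔ R.mov (u⁻¹ * v) := by
    simpa using R.mov_mul_le u (u⁻¹ * v)
  have h2 := Submodule.finrank_add_le_finrank_add_finrank (R.mov u) (R.mov (u⁻¹ * v))
  rw [Submodule.eq_of_le_of_finrank_le h1 (h2.trans h.le)]
  exact le_sup_left

omit [Finite W] [Finite B] in
theorem simple_mem_mov_mul {i : B} {w : W} (h : R.α i ∉ R.mov w) :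
    R.α i ∈ R.mov (cs.simple i * w) := by
  rw [mem_mov_iff]
  intro z hz
  by_contra hne
  rw [mul_apply] at hz
  have hwz : R.ρ w z = R.ρ (cs.simple i) z := by
    nth_rw 2 [← hz]
    rw [simple_apply_simple_apply]
  have hmem := R.apply_sub_mem_mov w z
  rw [hwz, simple_apply, sub_sub_cancel_left, neg_mem_iff] at hmem
  refine h (((R.mov w).smul_mem_iff ?_).1 hmem)
  have h0 : ⟪R.α i, R.α i⟫_ℝ ≠ 0 := inner_self_ne_zero.2 (R.α.ne_zero i)
  rw [real_inner_comm] at hne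
  positivity

omit [Finite W] [Finite B] in
theorem finrank_mov_simple_mul {i : B} {w : W} (h : R.α i ∉ R.mov w) :
    finrank ℝ (R.mov (cs.simple i * w)) = finrank ℝ (R.mov w) + 1 := by
  rw [← (R.isReflIn_simple i).finrank_mov_mul (R.simple_mem_mov_mul h),
    cs.simple_mul_simple_cancel_left]

theorem simple_mul_absLe {i : B} {u c : W} (hc : R.α i ∉ R.mov c) (hu : R.α i ∈ R.mov u)
    (h : absLe cs u (cs.simple i * c)) : absLe cs (cs.simple i * u) c := by
  rw [R.absLe_iff] at h ⊢
  rw [R.finrank_mov_simple_mul hc, ← (R.isReflIn_simple i).finrank_mov_mul hu] at h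
  rw [mul_inv_rev, cs.inv_simple, mul_assoc]
  lia

theorem simple_mul_absLe_simple_mul {i : B} {z c : W} (hc : R.α i ∉ R.mov c)
    (h : absLe cs z c) : absLe cs (cs.simple i * z) (cs.simple i * c) := by
  have hz : R.α i ∉ R.mov z := fun hz ↦ hc (R.mov_le_of_absLe h hz)
  rw [R.absLe_iff] at h ⊢
  rw [R.finrank_mov_simple_mul hc, R.finrank_mov_simple_mul hz, mul_inv_rev, cs.inv_simple,
    mul_assoc, cs.simple_mul_simple_cancel_left]
  lia

theorem mem_posCone_mov_iff {i : B} {u : W} (hi : R.α i ∈ R.mov u)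
    (hker : R.mov (cs.simple i * u) ≤ LinearMap.ker (R.α.coord i)) {x : V} :
    x ∈ R.posCone (R.mov u) ↔ 0 ≤ R.α.coord i x ∧
      x - R.α.coord i x • R.α i ∈ R.posCone (R.mov (cs.simple i * u)) := by
  refine mem_posCone_iff hi ((R.isReflIn_simple i).mov_mul_le hi) (fun y ↦ ?_)
    (R.span_isRoot_mem_mov _).ge
  refine ⟨fun hy ↦ ⟨(R.isReflIn_simple i).mov_mul_le hi hy, hker hy⟩, fun ⟨hy, hy0⟩ ↦ ?_⟩
  rw [(R.isReflIn_simple i).mov_eq_sup hi, Submodule.mem_sup] at hy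
  obtain ⟨a, ha, b, hb, rfl⟩ := hy
  obtain ⟨k, rfl⟩ := Submodule.mem_span_singleton.1 ha
  have hb0 : R.α.coord i b = 0 := hker hb
  rw [map_add, hb0, map_smul, Basis.coord_apply, R.α.repr_self, Finsupp.single_eq_same,
    smul_eq_mul, mul_one, add_zero] at hy0
  rwa [hy0, zero_smul, zero_add]

omit [Finite W] [Finite B] [FiniteDimensional ℝ V] in
theorem simple_notMem {i : B} (h : U ≤ LinearMap.ker (R.α.coord i)) : R.α i ∉ U := by
  intro hi
  have := h hi
  simp at this

/-- The positive cones of `u` and `v` meet in the positive cone of an element below `c`. -/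
def HasConeInf (c u v : W) : Prop :=
  ∃ z, absLe cs z c ∧ ∀ x, x ∈ R.posCone (R.mov z) ↔
    x ∈ R.posCone (R.mov u) ∧ x ∈ R.posCone (R.mov v)

variable {R} {i : B} {c u v : W}

theorem HasConeInf.of_simple_mul (hc : R.mov c ≤ LinearMap.ker (R.α.coord i))
    (hu : absLe cs u (cs.simple i * c)) (hv : absLe cs v (cs.simple i * c))
    (hiu : R.α i ∈ R.mov u) (hiv : R.α i ∈ R.mov v)
    (h : R.HasConeInf c (cs.simple i * u) (cs.simple i * v)) :
    R.HasConeInf (cs.simple i * c) u v := by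
  obtain ⟨z, hz, hzx⟩ := h
  have hci := R.simple_notMem hc
  have hzi : R.α i ∉ R.mov z := fun h ↦ hci (R.mov_le_of_absLe hz h)
  refine ⟨cs.simple i * z, R.simple_mul_absLe_simple_mul hci hz, fun x ↦ ?_⟩
  rw [R.mem_posCone_mov_iff hiu ((R.mov_le_of_absLe (R.simple_mul_absLe hci hiu hu)).trans hc),
    R.mem_posCone_mov_iff hiv ((R.mov_le_of_absLe (R.simple_mul_absLe hci hiv hv)).trans hc),
    R.mem_posCone_mov_iff (R.simple_mem_mov_mul hzi), cs.simple_mul_simple_cancel_left, hzx]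
  · tauto
  · rw [cs.simple_mul_simple_cancel_left]
    exact (R.mov_le_of_absLe hz).trans hc

theorem simple_apply_mem_posCone_of_mem (hi : R.α i ∈ R.mov u)
    (hker : R.mov (cs.simple i * u) ≤ LinearMap.ker (R.α.coord i)) (hiU : R.α i ∉ U) {x : V}
    (hx : x ∈ R.posCone (R.mov u)) (hx' : x ∈ R.posCone U) :
    R.ρ (cs.simple i) x ∈ R.posCone (R.mov u) := by
  have hpos := isPos_iff.1 (isPos_of_mem_posCone (simple_apply_mem_posCone hiU hx')) i
  rw [R.mem_posCone_mov_iff hi hker] at hx ⊢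
  refine ⟨hpos, ?_⟩
  convert hx.2 using 1
  rw [R.simple_apply, map_sub, map_smul, Basis.coord_apply _ _ (R.α i), R.α.repr_self,
    Finsupp.single_eq_same, smul_eq_mul, mul_one]
  module

theorem simple_apply_mem_posCone_and (hi : R.α i ∈ R.mov u)
    (hker : R.mov (cs.simple i * u) ≤ LinearMap.ker (R.α.coord i)) (hiU : R.α i ∉ U) {x : V} :
    x ∈ R.posCone (R.mov u) ∧ x ∈ R.posCone U ↔
      R.ρ (cs.simple i) x ∈ R.posCone ((R.mov u).map (R.ρ (cs.simple i))) ∧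
      R.ρ (cs.simple i) x ∈ R.posCone (U.map (R.ρ (cs.simple i))) := by
  rw [R.map_simple_eq_of_mem hi]
  constructor <;> rintro ⟨h, h'⟩
  · exact ⟨simple_apply_mem_posCone_of_mem hi hker hiU h h', simple_apply_mem_posCone hiU h'⟩
  · have hiU' := mt R.simple_mem_map_simple_iff.1 hiU
    have h1 := simple_apply_mem_posCone_of_mem hi hker hiU' h h'
    have h2 := simple_apply_mem_posCone hiU' h'
    rw [R.simple_apply_simple_apply] at h1 h2
    rw [R.map_simple_map_simple] at h2
    exact ⟨h1, h2⟩

omit [Finite W] [Finite B] [FiniteDimensional ℝ V] in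
theorem simple_apply_mem_posCone_iff (hi : R.α i ∉ U) {x : V} :
    R.ρ (cs.simple i) x ∈ R.posCone (U.map (R.ρ (cs.simple i))) ↔ x ∈ R.posCone U := by
  refine ⟨fun h ↦ ?_, simple_apply_mem_posCone hi⟩
  have h1 := simple_apply_mem_posCone (mt R.simple_mem_map_simple_iff.1 hi) h
  rwa [R.simple_apply_simple_apply, R.map_simple_map_simple] at h1

theorem simple_apply_mem_posCone_inf (hc : R.mov c ≤ LinearMap.ker (R.α.coord i))
    (hu : absLe cs u (cs.simple i * c)) (hv : absLe cs v (cs.simple i * c))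
    (hi : ¬(R.α i ∈ R.mov u ∧ R.α i ∈ R.mov v)) {x : V} :
    x ∈ R.posCone (R.mov u) ∧ x ∈ R.posCone (R.mov v) ↔
      R.ρ (cs.simple i) x ∈ R.posCone (R.mov (cs.simple i * u * cs.simple i)) ∧
      R.ρ (cs.simple i) x ∈ R.posCone (R.mov (cs.simple i * v * cs.simple i)) := by
  have hci := R.simple_notMem hc
  rw [R.mov_simple_conj, R.mov_simple_conj]
  by_cases hiu : R.α i ∈ R.mov u
  · exact simple_apply_mem_posCone_and hiu
      ((R.mov_le_of_absLe (R.simple_mul_absLe hci hiu hu)).trans hc) fun h ↦ hi ⟨hiu, h⟩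
  by_cases hiv : R.α i ∈ R.mov v
  · rw [and_comm, simple_apply_mem_posCone_and hiv
      ((R.mov_le_of_absLe (R.simple_mul_absLe hci hiv hv)).trans hc) hiu, and_comm]
  · rw [simple_apply_mem_posCone_iff hiu, simple_apply_mem_posCone_iff hiv]

theorem HasConeInf.of_conj (hc : R.mov c ≤ LinearMap.ker (R.α.coord i))
    (hu : absLe cs u (cs.simple i * c)) (hv : absLe cs v (cs.simple i * c))
    (hi : ¬(R.α i ∈ R.mov u ∧ R.α i ∈ R.mov v))
    (h : R.HasConeInf (c * cs.simple i) (cs.simple i * u * cs.simple i)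
      (cs.simple i * v * cs.simple i)) :
    R.HasConeInf (cs.simple i * c) u v := by
  obtain ⟨z, hz, hzx⟩ := h
  have hz' := R.absLe_conj hz (cs.simple i)
  rw [cs.inv_simple, ← mul_assoc, cs.simple_mul_simple_cancel_right] at hz'
  refine ⟨cs.simple i * z * cs.simple i, hz', fun x ↦ ?_⟩
  rw [simple_apply_mem_posCone_inf hc hu hv hi, ← hzx, ← simple_apply_mem_posCone_iff (i := i),
    ← R.mov_simple_conj]
  · simp [mul_assoc]
  · rw [R.mov_simple_conj, R.simple_mem_map_simple_iff]
    intro hiz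
    have h1 := (hzx _).1 ((R.isPosRoot_simple i).mem_posCone hiz)
    have h2 := mem_of_mem_posCone h1.1
    have h3 := mem_of_mem_posCone h1.2
    rw [R.mov_simple_conj, R.simple_mem_map_simple_iff] at h2 h3
    exact hi ⟨h2, h3⟩

end FiniteDimensional

end EuclideanRealization

namespace EuclideanRealization

variable {B W : Type*} [Group W] {M : CoxeterMatrix B} {cs : CoxeterSystem M W}
  {V : Type*} [NormedAddCommGroup V] [InnerProductSpace ℝ V] (R : EuclideanRealization cs V)

include R in
theorem finiteDimensional [Finite B] : FiniteDimensional ℝ V :=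
  R.α.finiteDimensional_of_finite

theorem inv_mul_apply_eq_iff {v w : W} {x y : V} :
    R.ρ (v⁻¹ * w) x = y ↔ R.ρ w x = R.ρ v y := by
  rw [mul_apply, ← (R.injective v).eq_iff, apply_inv_apply]

theorem mov_prod_simple_le {i : B} {l : List B} (hi : i ∉ l) :
    R.mov (l.map cs.simple).prod ≤ LinearMap.ker (R.α.coord i) := by
  induction l with
  | nil => rw [List.map_nil, List.prod_nil, mov_one]; exact bot_le
  | cons j l ih =>
    rw [List.mem_cons, not_or] at hi
    rw [List.map_cons, List.prod_cons]
    refine (R.mov_mul_le _ _).trans (sup_le ?_ (ih hi.2))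
    rw [(R.isReflIn_simple j).mov_eq, Submodule.span_singleton_le_iff_mem, LinearMap.mem_ker,
      Basis.coord_apply, R.α.repr_self, Finsupp.single_eq_of_ne hi.1]

variable [FiniteDimensional ℝ V] [Finite W] [Finite B]

variable {R} in
/-- Conjugating by a Coxeter element transports a failure of `HasConeInf`, and maps the
intersection of the two cones into the new one. -/
theorem not_hasConeInf_rotate (k l : List B) (hnd : (k ++ l).Nodup)
    (ih : ∀ l' : List B, l'.length < (k ++ l).length → l'.Nodup → ∀ u v,
      absLe cs u (l'.map cs.simple).prod → absLe cs v (l'.map cs.simple).prod →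
      R.HasConeInf (l'.map cs.simple).prod u v)
    (u v : W) (hu : absLe cs u ((k ++ l).map cs.simple).prod)
    (hv : absLe cs v ((k ++ l).map cs.simple).prod)
    (hnot : ¬ R.HasConeInf ((k ++ l).map cs.simple).prod u v) :
    ∃ g, g = (k.map cs.simple).prod ∧
      absLe cs (g⁻¹ * u * g) ((l ++ k).map cs.simple).prod ∧
      absLe cs (g⁻¹ * v * g) ((l ++ k).map cs.simple).prod ∧
      ¬ R.HasConeInf ((l ++ k).map cs.simple).prod (g⁻¹ * u * g) (g⁻¹ * v * g) ∧
      ∀ x, x ∈ R.posCone (R.mov u) ∧ x ∈ R.posCone (R.mov v) →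
        R.ρ g⁻¹ x ∈ R.posCone (R.mov (g⁻¹ * u * g)) ∧
        R.ρ g⁻¹ x ∈ R.posCone (R.mov (g⁻¹ * v * g)) := by
  induction k generalizing l u v with
  | nil => exact ⟨1, by simp, by simpa using hu, by simpa using hv, by simpa using hnot, by simp⟩
  | cons i k hk =>
    have hnd' : (k ++ l).Nodup := (List.nodup_cons.1 hnd).2
    have hc := R.mov_prod_simple_le (List.nodup_cons.1 hnd).1
    have hrot : ((k ++ (l ++ [i])).map cs.simple).prod =
        ((k ++ l).map cs.simple).prod * cs.simple i := by simp [mul_assoc]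
    rw [List.cons_append, List.map_cons, List.prod_cons] at hu hv hnot
    have hi : ¬(R.α i ∈ R.mov u ∧ R.α i ∈ R.mov v) := fun hi ↦ hnot <| by
      have hci := R.simple_notMem hc
      exact .of_simple_mul hc hu hv hi.1 hi.2 <| ih _ (by simp) hnd' _ _
        (R.simple_mul_absLe hci hi.1 hu) (R.simple_mul_absLe hci hi.2 hv)
    have hconj : ∀ w, absLe cs w (cs.simple i * ((k ++ l).map cs.simple).prod) →
        absLe cs (cs.simple i * w * cs.simple i) ((k ++ (l ++ [i])).map cs.simple).prod := by
      intro w hw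
      have := R.absLe_conj hw (cs.simple i)
      rwa [cs.inv_simple, cs.simple_mul_simple_cancel_left, ← hrot] at this
    obtain ⟨g, hg, hgu, hgv, hgnot, hgx⟩ := hk (l ++ [i])
      (by rw [← List.append_assoc]
          exact (List.perm_append_singleton i (k ++ l)).nodup_iff.2 hnd)
      (fun l' hl' ↦ ih l' (by simpa [add_assoc] using hl')) _ _ (hconj u hu) (hconj v hv)
      (fun h ↦ hnot (.of_conj hc hu hv hi (hrot ▸ h)))
    have he : ∀ w, (cs.simple i * g)⁻¹ * w * (cs.simple i * g) =
        g⁻¹ * (cs.simple i * w * cs.simple i) * g := fun w ↦ by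
      rw [mul_inv_rev, cs.inv_simple]; simp only [mul_assoc]
    have hlk : l ++ i :: k = l ++ [i] ++ k := by simp
    refine ⟨cs.simple i * g, by rw [hg, List.map_cons, List.prod_cons], ?_⟩
    rw [he, he, hlk]
    refine ⟨hgu, hgv, hgnot, fun x hx ↦ ?_⟩
    rw [mul_inv_rev, mul_apply, cs.inv_simple]
    exact hgx _ ((simple_apply_mem_posCone_inf hc hu hv hi).1 hx)

/-- Below a product of distinct simple reflections, the positive cones of the moved spaces are
closed under intersection. -/
theorem hasConeInf {l : List B} (hnd : l.Nodup) {u v : W}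
    (hu : absLe cs u (l.map cs.simple).prod) (hv : absLe cs v (l.map cs.simple).prod) :
    R.HasConeInf (l.map cs.simple).prod u v := by
  induction hn : l.length using Nat.strong_induction_on generalizing l u v with
  | _ n ih =>
  subst hn
  by_contra hnot
  set c := (l.map cs.simple).prod with hc
  have hiter : ∀ m : ℕ, ∃ u' v', absLe cs u' c ∧ absLe cs v' c ∧ ¬ R.HasConeInf c u' v' ∧
      ∀ x, x ∈ R.posCone (R.mov u) ∧ x ∈ R.posCone (R.mov v) →
        R.ρ (c⁻¹ ^ m) x ∈ R.posCone (R.mov u') ∧ R.ρ (c⁻¹ ^ m) x ∈ R.posCone (R.mov v') := by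
    intro m
    induction m with
    | zero => exact ⟨u, v, hu, hv, hnot, by simp⟩
    | succ m hm =>
      obtain ⟨u', v', hu', hv', hnot', hx⟩ := hm
      have h := not_hasConeInf_rotate l [] (by simpa using hnd)
        (fun l' hl' hnd' u v hu hv ↦ ih l'.length (by simpa using hl') hnd' hu hv rfl) u' v'
        (by simpa using hu') (by simpa using hv') (by simpa using hnot')
      obtain ⟨g, hg, h1, h2, h3, h4⟩ := h
      rw [← hc] at hg
      subst hg
      refine ⟨_, _, h1, h2, h3, fun x hxuv ↦ ?_⟩
      rw [pow_succ', mul_apply]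
      exact h4 _ (hx x hxuv)
  have hzero : ∀ x, x ∈ R.posCone (R.mov u) ∧ x ∈ R.posCone (R.mov v) → x = 0 := by
    intro x hx
    have hpos : ∀ m : ℕ, R.IsPos (R.ρ (c⁻¹ ^ m) x) := fun m ↦ by
      obtain ⟨u', v', -, -, -, h⟩ := hiter m
      exact isPos_of_mem_posCone (h x hx).1
    have hxc : x ∈ R.mov c := R.mov_le_of_absLe hu (mem_of_mem_posCone hx.1)
    have hmov : ∀ m : ℕ, R.ρ (c⁻¹ ^ m) x ∈ R.mov c := fun m ↦ by
      have h := R.mem_mov_conj (g := c ^ m) (w := c) (x := x)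
      rw [(Commute.refl c).pow_left m, mul_inv_cancel_right] at h
      rw [inv_pow]
      exact h.1 hxc
    obtain ⟨N, hN⟩ : ∃ N, orderOf c⁻¹ = N + 1 :=
      Nat.exists_eq_succ_of_ne_zero (orderOf_pos c⁻¹).ne'
    have hN1 : c⁻¹ ^ (N + 1) = 1 := hN ▸ pow_orderOf_eq_one c⁻¹
    set y := ∑ m ∈ Finset.range (N + 1), R.ρ (c⁻¹ ^ m) x with hy
    have hyfix : R.ρ c⁻¹ y = y := by
      have h1 : R.ρ c⁻¹ y = ∑ m ∈ Finset.range (N + 1), R.ρ (c⁻¹ ^ (m + 1)) x := by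
        rw [hy, map_sum]
        exact Finset.sum_congr rfl fun m _ ↦ by rw [pow_succ', mul_apply]
      rw [h1, Finset.sum_range_succ, hN1, hy, Finset.sum_range_succ', pow_zero]
    have hy0 : y = 0 := by
      have hyc : y ∈ R.mov c⁻¹ := by
        rw [mov_inv]
        exact sum_mem fun m _ ↦ hmov m
      exact inner_self_eq_zero.1 (R.mem_mov_iff.1 hyc y hyfix)
    rw [hy, Finset.sum_range_succ', pow_zero, one_apply, add_comm] at hy0
    have hsum : R.IsPos (∑ m ∈ Finset.range N, R.ρ (c⁻¹ ^ (m + 1)) x) :=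
      Finset.sum_induction _ R.IsPos (fun _ _ ↦ IsPos.add) isPos_zero fun m _ ↦ hpos (m + 1)
    exact (isPos_of_mem_posCone hx.1).eq_zero_of_add hsum hy0
  refine hnot ⟨1, R.one_absLe c, fun x ↦ ⟨fun hx ↦ ?_, fun hx ↦ ?_⟩⟩
  · have h := mem_of_mem_posCone hx
    rw [mov_one, Submodule.mem_bot] at h
    subst h
    exact ⟨zero_mem _, zero_mem _⟩
  · rw [hzero x hx]
    exact zero_mem _

/-- Below a fixed element, the absolute order is the inclusion order on moved spaces. -/
theorem absLe_iff_mov_le {c u v : W} (hu : absLe cs u c) (hv : absLe cs v c) :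
    absLe cs u v ↔ R.mov u ≤ R.mov v := by
  refine ⟨R.mov_le_of_absLe, fun hle ↦ ?_⟩
  have hv' := hv
  rw [R.absLe_iff] at hu hv ⊢
  have hdisj : R.mov v ⊓ R.mov (v⁻¹ * c) = ⊥ := by
    have h1 : finrank ℝ (R.mov c) ≤ finrank ℝ (R.mov v ⊔ R.mov (v⁻¹ * c) : Submodule ℝ V) :=
      Submodule.finrank_mono (by simpa using R.mov_mul_le v (v⁻¹ * c))
    have h2 := Submodule.finrank_sup_add_finrank_inf_eq (R.mov v) (R.mov (v⁻¹ * c))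
    exact Submodule.finrank_eq_zero.1 (by lia)
  have hG : ∀ x, R.ρ c x - x ∈ R.mov v → R.ρ (v⁻¹ * c) x = x := by
    intro x hx
    rw [← sub_eq_zero, ← Submodule.mem_bot ℝ, ← hdisj]
    refine ⟨?_, R.apply_sub_mem_mov _ x⟩
    have h1 := R.apply_sub_mem_mov v⁻¹ (R.ρ c x)
    rw [mov_inv] at h1
    change _ ∈ R.mov v
    convert add_mem h1 hx using 1
    rw [mul_apply]; abel
  have hfix : ∀ x, x ∈ R.fix v → x ∈ R.fix u := by
    intro x hx
    rw [fix_eq] at hx ⊢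
    exact Submodule.orthogonal_le hle hx
  have hsup : R.fix (u⁻¹ * c) ⊔ R.fix v ≤ R.fix (u⁻¹ * v) := by
    refine sup_le (fun x hx ↦ ?_) fun x hx ↦ ?_
    · rw [mem_fix, inv_mul_apply_eq_iff] at hx ⊢
      rw [← hx, eq_comm, ← R.inv_mul_apply_eq_iff]
      exact hG x (hle (hx ▸ R.apply_sub_mem_mov u x))
    · have hxu := hfix x hx
      rw [mem_fix] at hx hxu ⊢
      rw [inv_mul_apply_eq_iff, hx, hxu]
  have hinf : R.fix (u⁻¹ * c) ⊓ R.fix v ≤ R.fix c := by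
    rintro x ⟨hx, hxv⟩
    have hxu := R.mem_fix.1 (hfix x hxv)
    rw [mem_fix, R.inv_mul_apply_eq_iff.1 (R.mem_fix.1 hx), hxu]
  have h1 := Submodule.finrank_mono hsup
  have h2 := Submodule.finrank_mono hinf
  have h3 := Submodule.finrank_sup_add_finrank_inf_eq (R.fix (u⁻¹ * c)) (R.fix v)
  have h4 := R.finrank_mov_add_finrank_fix (u⁻¹ * c)
  have h5 := R.finrank_mov_add_finrank_fix v
  have h6 := R.finrank_mov_add_finrank_fix c
  have h7 := R.finrank_mov_add_finrank_fix (u⁻¹ * v)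
  have h8 : finrank ℝ (R.mov v) ≤ finrank ℝ (R.mov u) + finrank ℝ (R.mov (u⁻¹ * v)) := by
    have := R.finrank_mov_mul_le u (u⁻¹ * v)
    rwa [mul_inv_cancel_left] at this
  lia

theorem mov_le_iff {u : W} {U : Submodule ℝ V} :
    R.mov u ≤ U ↔ ∀ β, R.IsPosRoot β → β ∈ R.mov u → β ∈ U := by
  refine ⟨fun h β _ hβ ↦ h hβ, fun h ↦ ?_⟩
  rw [← R.span_isRoot_mem_mov u]
  exact Submodule.span_le.2 fun β hβ ↦ h β hβ.1 hβ.2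

include R

theorem absLe_refl (u : W) : absLe cs u u := by
  rw [R.absLe_iff, inv_mul_cancel, mov_one, finrank_bot, add_zero]

theorem exists_absLe_inf {l : List B} (hnd : l.Nodup) {u v : W}
    (hu : absLe cs u (l.map cs.simple).prod) (hv : absLe cs v (l.map cs.simple).prod) :
    ∃ z, absLe cs z (l.map cs.simple).prod ∧ absLe cs z u ∧ absLe cs z v ∧
      ∀ r, absLe cs r (l.map cs.simple).prod → absLe cs r u → absLe cs r v → absLe cs r z := by
  obtain ⟨z, hz, hzx⟩ := R.hasConeInf hnd hu hv
  refine ⟨z, hz, (R.absLe_iff_mov_le hz hu).2 (R.mov_le_iff.2 fun β hβ hβz ↦ ?_),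
    (R.absLe_iff_mov_le hz hv).2 (R.mov_le_iff.2 fun β hβ hβz ↦ ?_), fun r hr hru hrv ↦
    (R.absLe_iff_mov_le hr hz).2 (R.mov_le_iff.2 fun β hβ hβr ↦ ?_)⟩
  · exact mem_of_mem_posCone ((hzx β).1 (hβ.mem_posCone hβz)).1
  · exact mem_of_mem_posCone ((hzx β).1 (hβ.mem_posCone hβz)).2
  · exact mem_of_mem_posCone ((hzx β).2 ⟨hβ.mem_posCone (R.mov_le_of_absLe hru hβr),
      hβ.mem_posCone (R.mov_le_of_absLe hrv hβr)⟩)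

theorem exists_absLe_sup {l : List B} (hnd : l.Nodup) {u v : W}
    (hu : absLe cs u (l.map cs.simple).prod) (hv : absLe cs v (l.map cs.simple).prod) :
    ∃ j, absLe cs j (l.map cs.simple).prod ∧ absLe cs u j ∧ absLe cs v j ∧
      ∀ r, absLe cs r (l.map cs.simple).prod → absLe cs u r → absLe cs v r → absLe cs j r := by
  set c := (l.map cs.simple).prod
  obtain ⟨j, ⟨hj, huj, hvj⟩, hmin⟩ := (Set.toFinite
    {j | absLe cs j c ∧ absLe cs u j ∧ absLe cs v j}).exists_minimalFor
    (fun j ↦ finrank ℝ (R.mov j)) _ ⟨c, R.absLe_refl c, hu, hv⟩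
  refine ⟨j, hj, huj, hvj, fun r hr hur hvr ↦ ?_⟩
  obtain ⟨z, hz, hzj, hzr, hzmax⟩ := R.exists_absLe_inf hnd hj hr
  have hle := R.mov_le_of_absLe hzj
  have heq := Submodule.eq_of_le_of_finrank_le hle
    (hmin ⟨hz, hzmax u hu huj hur, hzmax v hv hvj hvr⟩ (Submodule.finrank_mono hle))
  rw [R.absLe_iff_mov_le hj hr, ← heq]
  exact R.mov_le_of_absLe hzr

end EuclideanRealization

/-- Let `(W, S)` be a finite (spherical) Coxeter system and `c` a Coxeter element (the
product of all the simple reflections, each occurring exactly once, in some order).  Then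
the poset `NC(W, c) = {u : W | u ≤_T c}` of non-crossing partitions, ordered by the
absolute order, is a lattice: any two elements `u, v` of `NC(W, c)` have a least upper
bound `j` and a greatest lower bound `z` within `NC(W, c)`. -/
theorem noncrossing_partition_lattice
    {B W : Type*} [Group W] [Finite W] [Finite B] {M : CoxeterMatrix B}
    (cs : CoxeterSystem M W)
    (l : List B) (hnd : l.Nodup) (hall : ∀ i : B, i ∈ l)
    (c : W) (hc : c = (l.map cs.simple).prod)
    (u v : W) (hu : absLe cs u c) (hv : absLe cs v c) :
    (∃ j : W, absLe cs j c ∧ absLe cs u j ∧ absLe cs v j ∧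
      ∀ r : W, absLe cs r c → absLe cs u r → absLe cs v r → absLe cs j r) ∧
    (∃ z : W, absLe cs z c ∧ absLe cs z u ∧ absLe cs z v ∧
      ∀ r : W, absLe cs r c → absLe cs r u → absLe cs r v → absLe cs r z) := by
  obtain ⟨_, _, ⟨R⟩⟩ := exists_euclideanRealization cs
  have := R.finiteDimensional
  subst hc
  exact ⟨R.exists_absLe_sup hnd hu hv, R.exists_absLe_inf hnd hu hv⟩
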